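/- Let (a₀,a₁,a₂) and (b₀,b₁,b₂) be orthonormal bases of ℝ³, set A_i = a_i·σ, B_i = b_i·σ, and define the 4×4 matrices D₀ = A₀⊗B₀ + A₁⊗B₁ + A₂⊗B₂, D₁ = A₀⊗B₂ − A₁⊗B₀ + A₂⊗B₁, D₂ = A₀⊗B₁ − A₁⊗B₂ + A₂⊗B₀. Let c₀,c₁,c₂ ∈ ℝ³ with ‖c_i‖ ≤ 1 and set C_i = c_i·σ. Let ρ be an 8×8 density matrix of the form ρ = ∑_λ q_λ (ρ_{AB}^λ ⊗ ρ_C^λ), where the sum is finite, q_λ ≥ 0, ∑_λ q_λ = 1, each ρ_C^λ is a 2×2 density matrix, and each ρ_{AB}^λ is a separable two-qubit density matrix (a finite convex combination of Kronecker products of 2×2 density matrices). Then |Re Tr((D₀⊗C₀ + D₁⊗C₁ + D₂⊗C₂) * ρ)| ≤ 3. -/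

import Mathlib

open Matrix ComplexOrder Kronecker

/-- The Pauli matrices. -/
noncomputable def pauli1 : Matrix (Fin 2) (Fin 2) ℂ := !![0, 1; 1, 0]
noncomputable def pauli2 : Matrix (Fin 2) (Fin 2) ℂ := !![0, -Complex.I; Complex.I, 0]
noncomputable def pauli3 : Matrix (Fin 2) (Fin 2) ℂ := !![1, 0; 0, -1]

/-- `n·σ` for `n ∈ ℝ³`. -/
noncomputable def dotSigma (n : EuclideanSpace ℝ (Fin 3)) : Matrix (Fin 2) (Fin 2) ℂ :=
  (n 0 : ℂ) • pauli1 + (n 1 : ℂ) • pauli2 + (n 2 : ℂ) • pauli3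

/-- A density matrix: positive semidefinite with unit trace. -/
def IsDensityMatrix {d : Type*} [Fintype d] [DecidableEq d]
    (ρ : Matrix d d ℂ) : Prop :=
  ρ.PosSemidef ∧ ρ.trace = 1

/-- A separable two-qubit density matrix: a finite convex combination of Kronecker
products of qubit density matrices. -/
def IsSeparableTwoQubit (ρ : Matrix (Fin 2 × Fin 2) (Fin 2 × Fin 2) ℂ) : Prop :=
  ∃ (n : ℕ) (p : Fin n → ℝ) (ρA ρB : Fin n → Matrix (Fin 2) (Fin 2) ℂ),
    (∀ k, 0 ≤ p k) ∧ (∑ k, p k = 1) ∧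
    (∀ k, IsDensityMatrix (ρA k)) ∧ (∀ k, IsDensityMatrix (ρB k)) ∧
    ρ = ∑ k, (p k : ℂ) • (ρA k ⊗ₖ ρB k)

/-- Every qubit density matrix has a Bloch vector in the closed unit ball. -/
theorem IsDensityMatrix.exists_bloch {ρ : Matrix (Fin 2) (Fin 2) ℂ} (hρ : IsDensityMatrix ρ) :
    ∃ r : EuclideanSpace ℝ (Fin 3), ‖r‖ ≤ 1 ∧
      ∀ m, (dotSigma m * ρ).trace = ((inner ℝ m r : ℝ) : ℂ) := by
  obtain ⟨hpos, htr⟩ := hρ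
  have hdet := (Complex.nonneg_iff.mp hpos.det_nonneg).1
  have h00 := hpos.isHermitian.apply 0 0
  have h11 := hpos.isHermitian.apply 1 1
  have h01 := hpos.isHermitian.apply 0 1
  rw [det_fin_two] at hdet
  rw [trace_fin_two] at htr
  simp only [Complex.ext_iff, Complex.star_def, Complex.conj_re, Complex.conj_im, Complex.add_re,
    Complex.add_im, Complex.one_re, Complex.one_im] at h00 h11 h01 htr
  simp only [Complex.sub_re, Complex.mul_re] at hdet
  obtain ⟨hre, him⟩ := h01
  have h00i : (ρ 0 0).im = 0 := by linarith [h00.2]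
  have h11i : (ρ 1 1).im = 0 := by linarith [h11.2]
  have h11r : (ρ 1 1).re = 1 - (ρ 0 0).re := by linarith [htr.1]
  have h01i : (ρ 0 1).im = -(ρ 1 0).im := by linarith
  rw [h00i, h11i, h11r, h01i, hre] at hdet
  refine ⟨!₂[2 * (ρ 0 1).re, -2 * (ρ 0 1).im, 2 * (ρ 0 0).re - 1], ?_, fun m => ?_⟩
  · rw [EuclideanSpace.norm_eq, Real.sqrt_le_one]
    simp only [Fin.sum_univ_three, Real.norm_eq_abs, sq_abs]
    simp [h01i]
    nlinarith
  · rw [trace_fin_two, Matrix.mul_apply, Matrix.mul_apply]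
    apply Complex.ext
    · simp [dotSigma, pauli1, pauli2, pauli3, Fin.sum_univ_two, PiLp.inner_apply,
        Fin.sum_univ_three, h00i, h11i, h11r, h01i, hre]
      ring
    · simp [dotSigma, pauli1, pauli2, pauli3, Fin.sum_univ_two, PiLp.inner_apply,
        Fin.sum_univ_three, h00i, h11i, h11r, h01i, hre]
      ring

theorem abs_sum_mul_le_of_abs_le {ι : Type*} [Fintype ι] {p t : ι → ℝ} {B : ℝ}
    (hp : ∀ k, 0 ≤ p k) (hsum : ∑ k, p k = 1) (ht : ∀ k, |t k| ≤ B) :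
    |∑ k, p k * t k| ≤ B :=
  calc |∑ k, p k * t k| ≤ ∑ k, |p k * t k| := Finset.abs_sum_le_sum_abs _ _
    _ ≤ ∑ k, p k * B := Finset.sum_le_sum fun k _ => by
        rw [abs_mul, abs_of_nonneg (hp k)]
        exact mul_le_mul_of_nonneg_left (ht k) (hp k)
    _ = B := by rw [← Finset.sum_mul, hsum, one_mul]

/-- A bound on expectation values in product states extends to separable states. -/
theorem IsSeparableTwoQubit.exists_trace_eq {M ρ : Matrix (Fin 2 × Fin 2) (Fin 2 × Fin 2) ℂ}
    {B : ℝ} (hρ : IsSeparableTwoQubit ρ)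
    (hM : ∀ ρA ρB : Matrix (Fin 2) (Fin 2) ℂ, IsDensityMatrix ρA → IsDensityMatrix ρB →
      ∃ d : ℝ, |d| ≤ B ∧ (M * (ρA ⊗ₖ ρB)).trace = d) :
    ∃ d : ℝ, |d| ≤ B ∧ (M * ρ).trace = d := by
  obtain ⟨n, p, ρA, ρB, hp, hsum, hA, hB, rfl⟩ := hρ
  choose d hd hMd using fun k => hM (ρA k) (ρB k) (hA k) (hB k)
  refine ⟨∑ k, p k * d k, abs_sum_mul_le_of_abs_le hp hsum hd, ?_⟩
  simp [Matrix.mul_sum, trace_sum, hMd]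

/-- Pairing the Bloch vectors of a product state with two orthonormal families. -/
theorem exists_trace_mul_kronecker_eq {a b : Fin 3 → EuclideanSpace ℝ (Fin 3)}
    (ha : Orthonormal ℝ a) (hb : Orthonormal ℝ b) {ρA ρB : Matrix (Fin 2) (Fin 2) ℂ}
    (hA : IsDensityMatrix ρA) (hB : IsDensityMatrix ρB) :
    ∃ x y : Fin 3 → ℝ, x 0 ^ 2 + x 1 ^ 2 + x 2 ^ 2 ≤ 1 ∧ y 0 ^ 2 + y 1 ^ 2 + y 2 ^ 2 ≤ 1 ∧
      ∀ i j, ((dotSigma (a i) ⊗ₖ dotSigma (b j)) * (ρA ⊗ₖ ρB)).trace = (x i : ℂ) * y j := by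
  have bessel {e : Fin 3 → EuclideanSpace ℝ (Fin 3)} (he : Orthonormal ℝ e)
      {r : EuclideanSpace ℝ (Fin 3)} (hr : ‖r‖ ≤ 1) :
      inner ℝ (e 0) r ^ 2 + inner ℝ (e 1) r ^ 2 + inner ℝ (e 2) r ^ 2 ≤ 1 := by
    have h := he.sum_inner_products_le r (s := Finset.univ)
    simp only [Fin.sum_univ_three, Real.norm_eq_abs, sq_abs] at h
    exact h.trans (pow_le_one₀ (norm_nonneg r) hr)
  obtain ⟨r, hr, htr⟩ := hA.exists_bloch
  obtain ⟨s, hs, hts⟩ := hB.exists_bloch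
  refine ⟨fun i => inner ℝ (a i) r, fun j => inner ℝ (b j) s, bessel ha hr, bessel hb hs,
    fun i j => ?_⟩
  rw [← mul_kronecker_mul, trace_kronecker, htr, hts]

/-- Case 1 of Theorem 4, the genuine steering inequality: if in every
branch of the model Alice and Bob share a separable state, then
`|Re Tr((D₀⊗C₀ + D₁⊗C₁ + D₂⊗C₂) ρ)| ≤ 3`. -/
theorem persistency_stmt4
    (a b : Fin 3 → EuclideanSpace ℝ (Fin 3))
    (ha : Orthonormal ℝ a) (hb : Orthonormal ℝ b)
    (c : Fin 3 → EuclideanSpace ℝ (Fin 3)) (hc : ∀ i, ‖c i‖ ≤ 1)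
    (n : ℕ) (q : Fin n → ℝ)
    (ρAB : Fin n → Matrix (Fin 2 × Fin 2) (Fin 2 × Fin 2) ℂ)
    (ρC : Fin n → Matrix (Fin 2) (Fin 2) ℂ)
    (hq : ∀ k, 0 ≤ q k) (hqsum : ∑ k, q k = 1)
    (hAB : ∀ k, IsSeparableTwoQubit (ρAB k)) (hC : ∀ k, IsDensityMatrix (ρC k))
    (ρ : Matrix ((Fin 2 × Fin 2) × Fin 2) ((Fin 2 × Fin 2) × Fin 2) ℂ)
    (hρ : ρ = ∑ k, (q k : ℂ) • (ρAB k ⊗ₖ ρC k)) :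
    |((((dotSigma (a 0) ⊗ₖ dotSigma (b 0) + dotSigma (a 1) ⊗ₖ dotSigma (b 1)
          + dotSigma (a 2) ⊗ₖ dotSigma (b 2)) ⊗ₖ dotSigma (c 0)
        + (dotSigma (a 0) ⊗ₖ dotSigma (b 2) - dotSigma (a 1) ⊗ₖ dotSigma (b 0)
          + dotSigma (a 2) ⊗ₖ dotSigma (b 1)) ⊗ₖ dotSigma (c 1)
        + (dotSigma (a 0) ⊗ₖ dotSigma (b 1) - dotSigma (a 1) ⊗ₖ dotSigma (b 2)
          + dotSigma (a 2) ⊗ₖ dotSigma (b 0)) ⊗ₖ dotSigma (c 2)) * ρ).trace.re)| ≤ 3 := by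
  have h0 (k : Fin n) := (hAB k).exists_trace_eq (B := 1)
    (M := dotSigma (a 0) ⊗ₖ dotSigma (b 0) + dotSigma (a 1) ⊗ₖ dotSigma (b 1)
      + dotSigma (a 2) ⊗ₖ dotSigma (b 2))
    fun ρA ρB hA hB => by
      obtain ⟨x, y, hx, hy, hxy⟩ := exists_trace_mul_kronecker_eq ha hb hA hB
      refine ⟨x 0 * y 0 + x 1 * y 1 + x 2 * y 2, ?_, ?_⟩
      · rw [abs_le]
        constructor <;> nlinarith [sq_nonneg (x 0 - y 0), sq_nonneg (x 0 + y 0),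
          sq_nonneg (x 1 - y 1), sq_nonneg (x 1 + y 1),
          sq_nonneg (x 2 - y 2), sq_nonneg (x 2 + y 2)]
      · simp only [add_mul, trace_add, hxy]
        push_cast
        ring
  have h1 (k : Fin n) := (hAB k).exists_trace_eq (B := 1)
    (M := dotSigma (a 0) ⊗ₖ dotSigma (b 2) - dotSigma (a 1) ⊗ₖ dotSigma (b 0)
      + dotSigma (a 2) ⊗ₖ dotSigma (b 1))
    fun ρA ρB hA hB => by
      obtain ⟨x, y, hx, hy, hxy⟩ := exists_trace_mul_kronecker_eq ha hb hA hB
      refine ⟨x 0 * y 2 - x 1 * y 0 + x 2 * y 1, ?_, ?_⟩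
      · rw [abs_le]
        constructor <;> nlinarith [sq_nonneg (x 0 - y 2), sq_nonneg (x 0 + y 2),
          sq_nonneg (x 1 - y 0), sq_nonneg (x 1 + y 0),
          sq_nonneg (x 2 - y 1), sq_nonneg (x 2 + y 1)]
      · simp only [add_mul, sub_mul, trace_add, trace_sub, hxy]
        push_cast
        ring
  have h2 (k : Fin n) := (hAB k).exists_trace_eq (B := 1)
    (M := dotSigma (a 0) ⊗ₖ dotSigma (b 1) - dotSigma (a 1) ⊗ₖ dotSigma (b 2)
      + dotSigma (a 2) ⊗ₖ dotSigma (b 0))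
    fun ρA ρB hA hB => by
      obtain ⟨x, y, hx, hy, hxy⟩ := exists_trace_mul_kronecker_eq ha hb hA hB
      refine ⟨x 0 * y 1 - x 1 * y 2 + x 2 * y 0, ?_, ?_⟩
      · rw [abs_le]
        constructor <;> nlinarith [sq_nonneg (x 0 - y 1), sq_nonneg (x 0 + y 1),
          sq_nonneg (x 1 - y 2), sq_nonneg (x 1 + y 2),
          sq_nonneg (x 2 - y 0), sq_nonneg (x 2 + y 0)]
      · simp only [add_mul, sub_mul, trace_add, trace_sub, hxy]
        push_cast
        ring
  choose d₀ hd₀ hD₀ using h0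
  choose d₁ hd₁ hD₁ using h1
  choose d₂ hd₂ hD₂ using h2
  choose r hr hρC using fun k => (hC k).exists_bloch
  have hz (k : Fin n) (i : Fin 3) : |inner ℝ (c i) (r k)| ≤ 1 :=
    (abs_real_inner_le_norm _ _).trans (mul_le_one₀ (hc i) (norm_nonneg _) (hr k))
  have hmul {x y : ℝ} (hx : |x| ≤ 1) (hy : |y| ≤ 1) : |x * y| ≤ 1 := by
    rw [abs_mul]
    exact mul_le_one₀ hx (abs_nonneg y) hy
  have hbranch (k : Fin n) : |d₀ k * inner ℝ (c 0) (r k) + d₁ k * inner ℝ (c 1) (r k)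
      + d₂ k * inner ℝ (c 2) (r k)| ≤ 3 := by
    refine (abs_add_three _ _ _).trans ?_
    linarith [hmul (hd₀ k) (hz k 0), hmul (hd₁ k) (hz k 1), hmul (hd₂ k) (hz k 2)]
  convert abs_sum_mul_le_of_abs_le hq hqsum hbranch using 2
  rw [hρ, Matrix.mul_sum, trace_sum, Complex.re_sum]
  refine Finset.sum_congr rfl fun k _ => ?_
  rw [Matrix.mul_smul, trace_smul, smul_eq_mul, Complex.re_ofReal_mul]
  congr 1
  rw [add_mul, add_mul, trace_add, trace_add, ← mul_kronecker_mul, ← mul_kronecker_mul,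
    ← mul_kronecker_mul, trace_kronecker, trace_kronecker, trace_kronecker, hD₀, hD₁, hD₂,
    hρC, hρC, hρC]
  norm_cast
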